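/- Let A, B : Matrix n n ℝ≥0 commute under the max-product, and suppose α is the Perron root of A (α is an eigenvalue of A and every eigenvalue of A is ≤ α) and μ is the Perron root of B. Then: (i) every eigenvalue γ of the max-product A ⊗ B satisfies γ ≤ α * μ; (ii) every eigenvalue γ of the entrywise maximum A ⊕ B (defined by (A ⊕ B) i j = max (A i j) (B i j)) satisfies γ ≤ max α μ; (iii) if moreover A and B are irreducible, then α * μ is an eigenvalue of A ⊗ B and max α μ is an eigenvalue of A ⊕ B. -/

import Mathlib

open scoped NNReal

/-- Max-algebraic product of matrices over ℝ≥0. -/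
noncomputable def maxMul {l m p : Type*} [Fintype m]
    (A : Matrix l m ℝ≥0) (B : Matrix m p ℝ≥0) : Matrix l p ℝ≥0 :=
  fun i k => ⨆ j, A i j * B j k

/-- Max-algebraic action of a matrix on a vector over ℝ≥0. -/
noncomputable def maxVec {l m : Type*} [Fintype m]
    (A : Matrix l m ℝ≥0) (v : m → ℝ≥0) : l → ℝ≥0 :=
  fun i => ⨆ j, A i j * v j

/-- `α` is a max-algebraic eigenvalue of `A`. -/
def IsMaxEig {n : Type*} [Fintype n] (A : Matrix n n ℝ≥0) (α : ℝ≥0) : Prop :=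
  ∃ v : n → ℝ≥0, v ≠ 0 ∧ maxVec A v = α • v

/-- A matrix over ℝ≥0 is irreducible if its positivity digraph is strongly connected. -/
def MaxIrreducible {n : Type*} (A : Matrix n n ℝ≥0) : Prop :=
  ∀ i j : n, i ≠ j → Relation.TransGen (fun a b => 0 < A a b) i j

section MaxVec

variable {l m n : Type*} [Fintype m] [Fintype n]

lemma mul_le_maxVec (A : Matrix l m ℝ≥0) (v : m → ℝ≥0) (i : l) (j : m) :
    A i j * v j ≤ maxVec A v i :=
  le_ciSup (f := fun j => A i j * v j) (Set.finite_range _).bddAbove j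

lemma maxVec_le {A : Matrix l m ℝ≥0} {v : m → ℝ≥0} {i : l} {c : ℝ≥0}
    (h : ∀ j, A i j * v j ≤ c) : maxVec A v i ≤ c :=
  ciSup_le' h

lemma exists_maxVec_eq [Nonempty m] (A : Matrix l m ℝ≥0) (v : m → ℝ≥0) (i : l) :
    ∃ j, A i j * v j = maxVec A v i :=
  exists_eq_ciSup_of_finite (f := fun j => A i j * v j)

lemma maxVec_mono (A : Matrix l m ℝ≥0) : Monotone (maxVec A) := fun _ _ h i =>
  maxVec_le fun j => (mul_le_mul_right (h j) _).trans (mul_le_maxVec A _ i j)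

lemma maxVec_smul (A : Matrix l m ℝ≥0) (c : ℝ≥0) (v : m → ℝ≥0) :
    maxVec A (c • v) = c • maxVec A v := by
  ext1 i
  simp only [maxVec, Pi.smul_apply, smul_eq_mul, NNReal.mul_iSup]
  exact iSup_congr fun j => by ring

lemma smul_maxVec (A : Matrix l m ℝ≥0) (c : ℝ≥0) (v : m → ℝ≥0) :
    maxVec (c • A) v = c • maxVec A v := by
  ext1 i
  simp only [maxVec, Pi.smul_apply, Matrix.smul_apply, smul_eq_mul, NNReal.mul_iSup]
  exact iSup_congr fun j => by ring

lemma maxVec_maxMul (A : Matrix l m ℝ≥0) (B : Matrix m n ℝ≥0) (v : n → ℝ≥0) :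
    maxVec (maxMul A B) v = maxVec A (maxVec B v) := by
  ext1 i
  refine le_antisymm (maxVec_le fun k => ?_) (maxVec_le fun j => ?_)
  · refine NNReal.iSup_mul_le fun j => ?_
    rw [mul_assoc]
    exact (mul_le_mul_right (mul_le_maxVec B v j k) _).trans (mul_le_maxVec A _ i j)
  · refine NNReal.mul_iSup_le fun k => ?_
    rw [← mul_assoc]
    refine le_trans (mul_le_mul_left ?_ _) (mul_le_maxVec (maxMul A B) v i k)
    exact le_ciSup (f := fun j => A i j * B j k) (Set.finite_range _).bddAbove j

lemma maxVec_max (A B : Matrix l m ℝ≥0) (v : m → ℝ≥0) :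
    maxVec (fun i j => max (A i j) (B i j)) v = maxVec A v ⊔ maxVec B v := by
  ext1 i
  refine le_antisymm (maxVec_le fun j => ?_) (sup_le (maxVec_le fun j => ?_)
    (maxVec_le fun j => ?_))
  · rw [max_mul]
    exact max_le_max (mul_le_maxVec A v i j) (mul_le_maxVec B v i j)
  · exact (mul_le_mul_left (le_max_left _ _) _).trans
      (mul_le_maxVec (fun i j => max (A i j) (B i j)) v i j)
  · exact (mul_le_mul_left (le_max_right _ _) _).trans
      (mul_le_maxVec (fun i j => max (A i j) (B i j)) v i j)

lemma continuous_maxVec (A : Matrix l m ℝ≥0) : Continuous (maxVec A) := by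
  refine continuous_pi fun i => ?_
  simp only [maxVec, ← Finset.sup_univ_eq_ciSup]
  exact Continuous.finset_sup_apply fun j _ => by fun_prop

end MaxVec

section Iterate

variable {n : Type*} [Fintype n] (A : Matrix n n ℝ≥0)

lemma iterate_maxVec_smul (k : ℕ) (c : ℝ≥0) (v : n → ℝ≥0) :
    (maxVec A)^[k] (c • v) = c • (maxVec A)^[k] v :=
  Function.Commute.iterate_left (f := maxVec A) (g := fun w => c • w)
    (fun w => maxVec_smul A c w) k v

lemma iterate_smul_maxVec (k : ℕ) (c : ℝ≥0) (v : n → ℝ≥0) :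
    (maxVec (c • A))^[k] v = c ^ k • (maxVec A)^[k] v := by
  induction k with
  | zero => simp
  | succ k ih =>
    rw [Function.iterate_succ_apply', Function.iterate_succ_apply', ih, maxVec_smul, smul_maxVec,
      smul_smul, pow_succ]

open Classical in
/-- The largest weight of a walk of length `k` from `i` to `j`, that is, the `(i, j)` entry of the
`k`-th max-algebraic power of `A`. -/
noncomputable def maxWalk (k : ℕ) (i j : n) : ℝ≥0 :=
  (maxVec A)^[k] (Pi.single j 1) i

lemma maxWalk_zero_self (i : n) : maxWalk A 0 i i = 1 := by
  simp [maxWalk]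

lemma maxWalk_mul_le (k : ℕ) (v : n → ℝ≥0) (i j : n) :
    maxWalk A k i j * v j ≤ (maxVec A)^[k] v i := by
  classical
  have h : v j • (Pi.single j 1 : n → ℝ≥0) ≤ v := by
    intro x
    by_cases hx : x = j
    · subst hx; simp
    · simp [hx]
  have := (maxVec_mono A).iterate k h i
  rw [iterate_maxVec_smul, Pi.smul_apply, smul_eq_mul, mul_comm] at this
  unfold maxWalk
  convert this

lemma mul_maxWalk_le (k : ℕ) (i j x : n) :
    A i j * maxWalk A k j x ≤ maxWalk A (k + 1) i x := by
  unfold maxWalk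
  rw [Function.iterate_succ_apply']
  exact mul_le_maxVec A _ i j

/-- An optimal walk realising `(maxVec A)^[k] v i` decomposes at any two intermediate times. -/
lemma exists_optimal_walk (k : ℕ) (v : n → ℝ≥0) (i : n) :
    ∃ p : ℕ → n, p 0 = i ∧ ∀ s t, s + t ≤ k → (maxVec A)^[k] v i ≤
      maxWalk A s i (p s) * maxWalk A t (p s) (p (s + t)) *
        (maxVec A)^[k - (s + t)] v (p (s + t)) := by
  induction k generalizing i with
  | zero =>
    refine ⟨fun _ => i, rfl, fun s t h => ?_⟩
    obtain ⟨rfl, rfl⟩ : s = 0 ∧ t = 0 := by omega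
    simp [maxWalk_zero_self]
  | succ k ih =>
    have : Nonempty n := ⟨i⟩
    obtain ⟨l, hl⟩ := exists_maxVec_eq A ((maxVec A)^[k] v) i
    obtain ⟨p, hp0, hp⟩ := ih l
    refine ⟨fun r => Nat.casesOn r i p, rfl, fun s t h => ?_⟩
    rw [Function.iterate_succ_apply', ← hl]
    rcases s with _ | s
    · rcases t with _ | t
      · change _ ≤ maxWalk A 0 i i * maxWalk A 0 i i * (maxVec A)^[k + 1] v i
        rw [maxWalk_zero_self, one_mul, one_mul, Function.iterate_succ_apply', hl]
      · have h1 := hp 0 t (by omega)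
        simp only [hp0, maxWalk_zero_self, one_mul, zero_add] at h1
        rw [show k + 1 - (0 + (t + 1)) = k - t by omega, zero_add]
        change _ ≤ maxWalk A 0 i i * maxWalk A (t + 1) i (p t) * _
        rw [maxWalk_zero_self, one_mul]
        refine (mul_le_mul_right h1 _).trans ?_
        rw [← mul_assoc]
        exact mul_le_mul_left (mul_maxWalk_le A t i l (p t)) _
    · have h1 := hp s t (by omega)
      rw [show k + 1 - (s + 1 + t) = k - (s + t) by omega, show s + 1 + t = s + t + 1 by omega]
      refine (mul_le_mul_right h1 _).trans ?_
      rw [← mul_assoc, ← mul_assoc]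
      exact mul_le_mul_left (mul_le_mul_left (mul_maxWalk_le A s i l (p s)) _) _

variable {A}

lemma exists_iterate_le_of_cycle_le_one
    (hA : ∀ m, 1 ≤ m → m ≤ Fintype.card n → ∀ j, maxWalk A m j j ≤ 1) (v : n → ℝ≥0) :
    ∃ C : ℝ≥0, ∀ k i, (maxVec A)^[k] v i ≤ C := by
  set N := Fintype.card n
  refine ⟨(Finset.range N).sup fun k => Finset.univ.sup ((maxVec A)^[k] v), fun k => ?_⟩
  induction k using Nat.strong_induction_on with
  | _ k ih =>
    intro i
    rcases lt_or_ge k N with hk | hk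
    · exact (Finset.le_sup (f := (maxVec A)^[k] v) (Finset.mem_univ i)).trans
        (Finset.le_sup (f := fun k => Finset.univ.sup ((maxVec A)^[k] v)) (Finset.mem_range.2 hk))
    · obtain ⟨p, -, hp⟩ := exists_optimal_walk A k v i
      obtain ⟨s, t, hst, ht, hpst⟩ : ∃ s t, 1 ≤ t ∧ s + t ≤ N ∧ p (s + t) = p s := by
        obtain ⟨x, y, hxy, he⟩ := Fintype.exists_ne_map_eq_of_card_lt
          (fun r : Fin (N + 1) => p r) (by simp [N])
        rcases lt_or_gt_of_ne (Fin.val_ne_of_ne hxy) with h | h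
        · exact ⟨x, y - x, by omega, by omega, by rw [Nat.add_sub_cancel' h.le]; exact he.symm⟩
        · exact ⟨y, x - y, by omega, by omega, by rw [Nat.add_sub_cancel' h.le]; exact he⟩
      have h1 := hp s t (by omega)
      rw [hpst] at h1
      calc (maxVec A)^[k] v i
          ≤ maxWalk A s i (p s) * 1 * (maxVec A)^[k - (s + t)] v (p s) :=
            h1.trans (mul_le_mul_left (mul_le_mul_right (hA t hst (by omega) _) _) _)
        _ ≤ (maxVec A)^[s] ((maxVec A)^[k - (s + t)] v) i := by
            rw [mul_one]; exact maxWalk_mul_le A s _ i (p s)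
        _ = (maxVec A)^[k - t] v i := by
            rw [← Function.iterate_add_apply, show s + (k - (s + t)) = k - t by omega]
        _ ≤ _ := ih (k - t) (by omega) i

lemma isMaxEig_one_of_cycle
    (hA : ∀ m, 1 ≤ m → m ≤ Fintype.card n → ∀ j, maxWalk A m j j ≤ 1)
    {m : ℕ} (hm : 1 ≤ m) {j : n} (hj : maxWalk A m j j = 1) : IsMaxEig A 1 := by
  classical
  obtain ⟨C, hC⟩ := exists_iterate_le_of_cycle_le_one hA (Pi.single j 1)
  have hle : ∀ k i, (maxVec A)^[k] (Pi.single j 1) i ≤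
      ⨆ k, (maxVec A)^[k] (Pi.single j 1) i := fun k i =>
    le_ciSup (f := fun k => (maxVec A)^[k] (Pi.single j 1) i)
      ⟨C, by rintro _ ⟨k, rfl⟩; exact hC k i⟩ k
  set z : n → ℝ≥0 := fun i => ⨆ k, (maxVec A)^[k] (Pi.single j 1) i
  have hsucc : ∀ k, (maxVec A)^[k + 1] (Pi.single j 1) ≤ maxVec A z := fun k => by
    rw [Function.iterate_succ_apply']
    exact maxVec_mono A (hle k)
  refine ⟨z, fun h => ?_, ?_⟩
  · have := hle 0 j
    rw [show (⨆ k, (maxVec A)^[k] (Pi.single j 1) j) = z j from rfl, h] at this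
    simp at this
  · rw [one_smul]
    refine le_antisymm (fun i => maxVec_le fun x => NNReal.mul_iSup_le fun k => ?_)
      (fun i => ciSup_le' fun k => ?_)
    · refine le_trans (mul_le_maxVec A _ i x) ?_
      rw [← Function.iterate_succ_apply' (maxVec A)]
      exact hle (k + 1) i
    · rcases k with _ | k
      · obtain ⟨m, rfl⟩ := Nat.exists_eq_add_of_le' hm
        by_cases hi : i = j
        · subst hi
          have := hsucc m i
          unfold maxWalk at hj
          calc _ = (1 : ℝ≥0) := by simp
            _ = _ := by convert hj.symm
            _ ≤ _ := this
        · simp [hi]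
      · exact hsucc k i

lemma IsMaxEig.smul {γ : ℝ≥0} (h : IsMaxEig A γ) (c : ℝ≥0) : IsMaxEig (c • A) (c * γ) := by
  obtain ⟨v, hv, h⟩ := h
  exact ⟨v, hv, by rw [smul_maxVec, h, smul_smul]⟩

lemma maxWalk_smul (c : ℝ≥0) (k : ℕ) (i j : n) :
    maxWalk (c • A) k i j = c ^ k * maxWalk A k i j := by
  simp [maxWalk, iterate_smul_maxVec]

/-- If no eigenvalue of `A` exceeds `a`, then neither does any geometric mean of a cycle. -/
lemma maxWalk_self_le_pow {a : ℝ≥0} (hA : ∀ γ, IsMaxEig A γ → γ ≤ a)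
    {m : ℕ} (hm : 1 ≤ m) (hmN : m ≤ Fintype.card n) (j : n) : maxWalk A m j j ≤ a ^ m := by
  set f : ℕ × n → ℝ≥0 := fun q => maxWalk A q.1 q.2 q.2 ^ ((q.1 : ℝ)⁻¹)
  have hpow : ∀ q : ℕ × n, 1 ≤ q.1 → f q ^ q.1 = maxWalk A q.1 q.2 q.2 := fun q hq =>
    NNReal.rpow_inv_natCast_pow _ (by omega)
  obtain ⟨⟨r, x⟩, hq, hmax⟩ := Finset.exists_max_image
    (Finset.Icc 1 (Fintype.card n) ×ˢ (Finset.univ : Finset n)) f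
    ⟨(m, j), by simp [hm, hmN]⟩
  simp only [Finset.mem_product, Finset.mem_Icc, Finset.mem_univ, and_true] at hq hmax
  have hcyc : ∀ m, 1 ≤ m → m ≤ Fintype.card n → ∀ j, maxWalk A m j j ≤ f (r, x) ^ m := by
    intro m hm hmN j
    rw [← hpow (m, j) hm]
    exact pow_le_pow_left' (hmax (m, j) ⟨hm, hmN⟩) m
  refine (hcyc m hm hmN j).trans (pow_le_pow_left' ?_ m)
  rcases eq_or_ne (f (r, x)) 0 with h0 | h0
  · rw [h0]; exact zero_le
  · apply hA
    have h1 : IsMaxEig ((f (r, x))⁻¹ • A) 1 := by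
      refine isMaxEig_one_of_cycle (m := r) (j := x) (fun m hm hmN j => ?_) hq.1 ?_
      · rw [maxWalk_smul, inv_pow, inv_mul_le_iff₀ (pow_pos (pos_iff_ne_zero.2 h0) _), mul_one]
        exact hcyc m hm hmN j
      · rw [maxWalk_smul, ← hpow (r, x) hq.1, ← mul_pow, inv_mul_cancel₀ h0, one_pow]
    simpa [smul_smul, h0] using h1.smul (f (r, x))

lemma exists_iterate_inv_smul_le {a : ℝ≥0} (ha : 0 < a) (hA : ∀ γ, IsMaxEig A γ → γ ≤ a) :
    ∃ C : ℝ≥0, ∀ k i, (maxVec (a⁻¹ • A))^[k] 1 i ≤ C := by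
  refine exists_iterate_le_of_cycle_le_one (fun m hm hmN j => ?_) _
  rw [maxWalk_smul, inv_pow, inv_mul_le_iff₀ (pow_pos ha _), mul_one]
  exact maxWalk_self_le_pow hA hm hmN j

end Iterate

section Commute

variable {n : Type*} [Fintype n] {A B : Matrix n n ℝ≥0}

lemma commute_maxVec (hcomm : maxMul A B = maxMul B A) :
    Function.Commute (maxVec A) (maxVec B) := fun v => by
  rw [← maxVec_maxMul, hcomm, maxVec_maxMul]

lemma commute_maxVec_smul (hcomm : maxMul A B = maxMul B A) (a b : ℝ≥0) :
    Function.Commute (maxVec (a • A)) (maxVec (b • B)) := fun v => by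
  simp only [smul_maxVec, maxVec_smul]
  rw [(commute_maxVec hcomm).eq, smul_comm]

/-- Commuting max-linear maps with bounded orbits have a common positive subeigenvector. -/
lemma exists_common_subfixed (hcomm : Function.Commute (maxVec A) (maxVec B))
    (hA : ∃ C : ℝ≥0, ∀ k i, (maxVec A)^[k] 1 i ≤ C)
    (hB : ∃ C : ℝ≥0, ∀ k i, (maxVec B)^[k] 1 i ≤ C) :
    ∃ u : n → ℝ≥0, (∀ i, 0 < u i) ∧ maxVec A u ≤ u ∧ maxVec B u ≤ u := by
  obtain ⟨C, hC⟩ := hA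
  obtain ⟨D, hD⟩ := hB
  set y : ℕ × ℕ → n → ℝ≥0 := fun q => (maxVec A)^[q.1] ((maxVec B)^[q.2] 1) with hy
  have hbdd : ∀ q i, y q i ≤ D * C := by
    intro q i
    have h1 : (maxVec B)^[q.2] 1 ≤ D • (1 : n → ℝ≥0) := fun i => by simpa using hD q.2 i
    refine ((maxVec_mono A).iterate q.1 h1 i).trans ?_
    rw [iterate_maxVec_smul]
    exact mul_le_mul_right (hC q.1 i) D
  have hle : ∀ q i, y q i ≤ ⨆ q, y q i := fun q i =>
    le_ciSup (f := fun q => y q i) ⟨D * C, by rintro _ ⟨q, rfl⟩; exact hbdd q i⟩ q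
  refine ⟨fun i => ⨆ q, y q i, fun i => ?_, fun i => ?_, fun i => ?_⟩
  · exact lt_of_lt_of_le (by simp [hy]) (hle (0, 0) i)
  · refine maxVec_le fun j => NNReal.mul_iSup_le fun q => ?_
    refine (mul_le_maxVec A (y q) i j).trans ?_
    have : maxVec A (y q) = y (q.1 + 1, q.2) := by
      simp only [hy, Function.iterate_succ_apply']
    rw [this]
    exact hle _ i
  · refine maxVec_le fun j => NNReal.mul_iSup_le fun q => ?_
    refine (mul_le_maxVec B (y q) i j).trans ?_
    have : maxVec B (y q) = y (q.1, q.2 + 1) := by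
      simp only [hy, Function.iterate_succ_apply']
      exact ((hcomm.iterate_left q.1).eq _).symm
    rw [this]
    exact hle _ i

lemma exists_common_subeigenvector (hcomm : maxMul A B = maxMul B A) {a b : ℝ≥0}
    (ha : 0 < a) (hb : 0 < b) (hA : ∀ γ, IsMaxEig A γ → γ ≤ a) (hB : ∀ γ, IsMaxEig B γ → γ ≤ b) :
    ∃ u : n → ℝ≥0, (∀ i, 0 < u i) ∧ maxVec A u ≤ a • u ∧ maxVec B u ≤ b • u := by
  obtain ⟨u, hu, hAu, hBu⟩ := exists_common_subfixed (commute_maxVec_smul hcomm a⁻¹ b⁻¹)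
    (exists_iterate_inv_smul_le ha hA) (exists_iterate_inv_smul_le hb hB)
  rw [smul_maxVec] at hAu hBu
  exact ⟨u, hu, fun i => (inv_mul_le_iff₀ ha).1 (hAu i), fun i => (inv_mul_le_iff₀ hb).1 (hBu i)⟩

lemma IsMaxEig.le_of_subeigenvector {γ c : ℝ≥0} (h : IsMaxEig A γ) {u : n → ℝ≥0}
    (hu : ∀ i, 0 < u i) (hc : maxVec A u ≤ c • u) : γ ≤ c := by
  obtain ⟨v, hv, h⟩ := h
  obtain ⟨i₀, hi₀⟩ := Function.ne_iff.1 hv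
  obtain ⟨i, -, hi⟩ := Finset.exists_max_image Finset.univ (fun i => v i / u i)
    ⟨i₀, Finset.mem_univ i₀⟩
  have hpos : 0 < v i / u i :=
    (div_pos (pos_iff_ne_zero.2 hi₀) (hu i₀)).trans_le (hi i₀ (Finset.mem_univ _))
  have hvu : v ≤ (v i / u i) • u := fun j => (div_le_iff₀ (hu j)).1 (hi j (Finset.mem_univ _))
  have hvi : v i = v i / u i * u i := (div_mul_cancel₀ _ (hu i).ne').symm
  have h1 := maxVec_mono A hvu i
  rw [h, maxVec_smul] at h1
  have h2 : γ * v i ≤ c * v i := calc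
    γ * v i ≤ v i / u i * maxVec A u i := h1
    _ ≤ v i / u i * (c * u i) := mul_le_mul_right (hc i) _
    _ = c * (v i / u i * u i) := by ring
    _ = c * v i := by rw [← hvi]
  exact le_of_mul_le_mul_right h2 (hvi ▸ mul_pos hpos (hu i))

lemma exists_le_smul {u : n → ℝ≥0} (hu : ∀ i, 0 < u i) (v : n → ℝ≥0) :
    ∃ c : ℝ≥0, v ≤ c • u :=
  ⟨Finset.univ.sup fun i => v i / u i, fun i => (div_le_iff₀ (hu i)).1
    (Finset.le_sup (f := fun i => v i / u i) (Finset.mem_univ i))⟩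

/-- Commuting max-linear maps, each with a positive fixed vector, have a common nonzero one. -/
lemma exists_common_fixed [Nonempty n] (hcomm : Function.Commute (maxVec A) (maxVec B))
    {v x : n → ℝ≥0} (hv : ∀ i, 0 < v i) (hx : ∀ i, 0 < x i)
    (hAv : maxVec A v = v) (hBx : maxVec B x = x) :
    ∃ w : n → ℝ≥0, w ≠ 0 ∧ maxVec A w = w ∧ maxVec B w = w := by
  obtain ⟨C, hC⟩ := exists_le_smul hv x
  obtain ⟨D, hD⟩ := exists_le_smul hx v
  have hAvk : ∀ k, (maxVec A)^[k] v = v := fun k => Function.iterate_fixed hAv k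
  have hB : ∀ k, maxVec B ((maxVec A)^[k] x) = (maxVec A)^[k] x := fun k => by
    rw [← (hcomm.iterate_left k).eq, hBx]
  have hbdd : ∀ k, (maxVec A)^[k] x ≤ C • v := fun k => by
    have := (maxVec_mono A).iterate k hC
    rwa [iterate_maxVec_smul, hAvk] at this
  have hle : ∀ k i, (maxVec A)^[k] x i ≤ ⨆ k, (maxVec A)^[k] x i := fun k i =>
    le_ciSup (f := fun k => (maxVec A)^[k] x i)
      ⟨C * v i, by rintro _ ⟨k, rfl⟩; exact hbdd k i⟩ k
  set z : n → ℝ≥0 := fun i => ⨆ k, (maxVec A)^[k] x i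
  have hAz : maxVec A z ≤ z := fun i => maxVec_le fun j => NNReal.mul_iSup_le fun k => by
    refine (mul_le_maxVec A _ i j).trans ?_
    rw [← Function.iterate_succ_apply' (maxVec A)]
    exact hle (k + 1) i
  have hBz : maxVec B z = z := by
    refine le_antisymm (fun i => maxVec_le fun j => NNReal.mul_iSup_le fun k => ?_)
      (fun i => ciSup_le' fun k => ?_)
    · refine (mul_le_maxVec B _ i j).trans ?_
      rw [hB]
      exact hle k i
    · conv_lhs => rw [← hB k]
      exact maxVec_mono B (hle k) i
  have hvz : v ≤ D • z := hD.trans fun i => mul_le_mul_right (hle 0 i) D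
  have hanti := (maxVec_mono A).antitone_iterate_of_map_le hAz
  have hlim : Filter.Tendsto (fun k => (maxVec A)^[k] z) Filter.atTop
      (nhds fun i => ⨅ k, (maxVec A)^[k] z i) :=
    tendsto_pi_nhds.2 fun i => tendsto_atTop_ciInf (fun _ _ h => hanti h i) (OrderBot.bddBelow _)
  set w : n → ℝ≥0 := fun i => ⨅ k, (maxVec A)^[k] z i
  refine ⟨w, fun h => ?_, ?_, ?_⟩
  · obtain ⟨i⟩ := ‹Nonempty n›
    have hvw : v i ≤ D * w i := by
      refine ge_of_tendsto' ((tendsto_pi_nhds.1 hlim i).const_mul D) fun k => ?_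
      have := (maxVec_mono A).iterate k hvz i
      rwa [hAvk, iterate_maxVec_smul] at this
    simp [h, (hv i).ne'] at hvw
  · refine tendsto_nhds_unique (((continuous_maxVec A).tendsto w).comp hlim) ?_
    refine (hlim.comp (Filter.tendsto_add_atTop_nat 1)).congr fun k => ?_
    simp [Function.iterate_succ_apply']
  · refine tendsto_nhds_unique (((continuous_maxVec B).tendsto w).comp hlim) ?_
    refine hlim.congr fun k => ?_
    simp only [Function.comp_apply]
    rw [← (hcomm.iterate_left k).eq, hBz]

end Commute

section Irreducible

variable {n : Type*} [Fintype n] {A : Matrix n n ℝ≥0}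

lemma MaxIrreducible.pos_of_eigenvector (hA : MaxIrreducible A) {γ : ℝ≥0} {v : n → ℝ≥0}
    (hv : v ≠ 0) (h : maxVec A v = γ • v) (i : n) : 0 < v i := by
  obtain ⟨j, hj⟩ := Function.ne_iff.1 hv
  have hj : 0 < v j := pos_iff_ne_zero.2 hj
  have hstep : ∀ a b, 0 < A a b → 0 < v b → 0 < v a := fun a b hab hb => by
    have h1 := (mul_pos hab hb).trans_le (mul_le_maxVec A v a b)
    rw [h] at h1
    exact pos_of_mul_pos_right h1 zero_le
  rcases eq_or_ne i j with rfl | hij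
  · exact hj
  · have ht := hA i j hij
    clear hij
    induction ht using Relation.TransGen.head_induction_on with
    | single h => exact hstep _ _ h hj
    | head h _ ih => exact hstep _ _ h ih

lemma MaxIrreducible.eigenvalue_pos [Nontrivial n] (hA : MaxIrreducible A) {γ : ℝ≥0}
    (hγ : IsMaxEig A γ) : 0 < γ := by
  obtain ⟨v, hv, h⟩ := hγ
  obtain ⟨i, j, hij⟩ := exists_pair_ne n
  obtain ⟨k, hk, -⟩ := Relation.TransGen.head'_iff.1 (hA i j hij)
  have h1 := (mul_pos hk (hA.pos_of_eigenvector hv h k)).trans_le (mul_le_maxVec A v i k)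
  rw [h] at h1
  exact pos_of_mul_pos_left h1 zero_le

lemma exists_common_eigenvector {B : Matrix n n ℝ≥0} (hcomm : maxMul A B = maxMul B A)
    {α μ : ℝ≥0} (hα : IsMaxEig A α) (hμ : IsMaxEig B μ)
    (hA : MaxIrreducible A) (hB : MaxIrreducible B) :
    ∃ w : n → ℝ≥0, w ≠ 0 ∧ maxVec A w = α • w ∧ maxVec B w = μ • w := by
  have hα' := hα
  have hμ' := hμ
  obtain ⟨v, hv, hAv⟩ := hα
  obtain ⟨x, hx, hBx⟩ := hμ
  have hvpos := hA.pos_of_eigenvector hv hAv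
  have hxpos := hB.pos_of_eigenvector hx hBx
  obtain ⟨i, -⟩ := Function.ne_iff.1 hv
  rcases subsingleton_or_nontrivial n with hn | hn
  · refine ⟨v, hv, hAv, ?_⟩
    have : v = (v i / x i) • x := by
      ext1 j
      rw [Subsingleton.elim j i, Pi.smul_apply, smul_eq_mul, div_mul_cancel₀ _ (hxpos i).ne']
    rw [this, maxVec_smul, hBx, smul_comm]
  · have hα0 := (hA.eigenvalue_pos hα').ne'
    have hμ0 := (hB.eigenvalue_pos hμ').ne'
    obtain ⟨w, hw, hAw, hBw⟩ := exists_common_fixed (commute_maxVec_smul hcomm α⁻¹ μ⁻¹)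
      hvpos hxpos (by rw [smul_maxVec, hAv, inv_smul_smul₀ hα0])
      (by rw [smul_maxVec, hBx, inv_smul_smul₀ hμ0])
    rw [smul_maxVec] at hAw hBw
    exact ⟨w, hw, (inv_smul_eq_iff₀ hα0).1 hAw, (inv_smul_eq_iff₀ hμ0).1 hBw⟩

end Irreducible

theorem perron_root_inequalities {n : Type*} [Fintype n]
    (A B : Matrix n n ℝ≥0) (hcomm : maxMul A B = maxMul B A)
    (α μ : ℝ≥0)
    (hα : IsMaxEig A α ∧ ∀ γ, IsMaxEig A γ → γ ≤ α)
    (hμ : IsMaxEig B μ ∧ ∀ γ, IsMaxEig B γ → γ ≤ μ) :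
    (∀ γ, IsMaxEig (maxMul A B) γ → γ ≤ α * μ) ∧
    (∀ γ, IsMaxEig (fun i j => max (A i j) (B i j)) γ → γ ≤ max α μ) ∧
    (MaxIrreducible A → MaxIrreducible B →
      IsMaxEig (maxMul A B) (α * μ) ∧
      IsMaxEig (fun i j => max (A i j) (B i j)) (max α μ)) := by
  refine ⟨fun γ hγ => ?_, fun γ hγ => ?_, fun hA hB => ?_⟩
  · suffices h : ∀ a > α, ∀ b > μ, γ ≤ a * b by
      have hlim : Filter.Tendsto (fun ε : ℝ≥0 => (α + ε) * (μ + ε)) (nhdsWithin 0 (Set.Ioi 0))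
          (nhds (α * μ)) := by
        have hcont : Continuous fun ε : ℝ≥0 => (α + ε) * (μ + ε) := by fun_prop
        simpa using (hcont.tendsto 0).mono_left nhdsWithin_le_nhds
      refine ge_of_tendsto hlim (Filter.eventually_of_mem self_mem_nhdsWithin fun ε hε => ?_)
      exact h _ (lt_add_of_pos_right α hε) _ (lt_add_of_pos_right μ hε)
    intro a ha b hb
    obtain ⟨u, hu, hAu, hBu⟩ := exists_common_subeigenvector hcomm (pos_of_gt ha) (pos_of_gt hb)
      (fun γ hγ => (hα.2 γ hγ).trans ha.le) (fun γ hγ => (hμ.2 γ hγ).trans hb.le)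
    refine hγ.le_of_subeigenvector hu ?_
    rw [maxVec_maxMul]
    refine (maxVec_mono A hBu).trans ?_
    rw [maxVec_smul, mul_comm, ← smul_smul]
    exact fun i => mul_le_mul_right (hAu i) b
  · refine le_of_forall_gt_imp_ge_of_dense fun c hc => ?_
    obtain ⟨u, hu, hAu, hBu⟩ := exists_common_subeigenvector hcomm (pos_of_gt hc) (pos_of_gt hc)
      (fun γ hγ => (hα.2 γ hγ).trans ((le_max_left _ _).trans hc.le))
      (fun γ hγ => (hμ.2 γ hγ).trans ((le_max_right _ _).trans hc.le))
    refine hγ.le_of_subeigenvector hu ?_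
    rw [maxVec_max]
    exact sup_le hAu hBu
  · obtain ⟨w, hw, hAw, hBw⟩ := exists_common_eigenvector hcomm hα.1 hμ.1 hA hB
    refine ⟨⟨w, hw, ?_⟩, ⟨w, hw, ?_⟩⟩
    · rw [maxVec_maxMul, hBw, maxVec_smul, hAw, smul_smul, mul_comm]
    · rw [maxVec_max, hAw, hBw]
      ext1 i
      simp only [Pi.sup_apply, Pi.smul_apply, smul_eq_mul, max_mul]
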